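/- arXiv:2602.07678 — 2 statements merged into one kernel-verified Lean document; each statement's English description precedes it below -/
import Mathlib

section
/- Let X be a topological space and 𝔞 an aura function on X. Then the following inclusions hold among the generalized open-set classes: (i) every open set is 𝔞-α-open; (ii) every 𝔞-α-open set is 𝔞-semi-open; (iii) every 𝔞-α-open set is 𝔞-pre-open; (iv) every 𝔞-semi-open set is 𝔞-b-open; (v) every 𝔞-pre-open set is 𝔞-b-open; (vi) every 𝔞-b-open set is 𝔞-β-open. -/
/-- The aura-closure of `A`: all points whose aura meets `A`. -/
def auraCl {X : Type*} (a : X → Set X) (A : Set X) : Set X :=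
  {x | (a x ∩ A).Nonempty}

/-- `A` is 𝔞-semi-open if `A ⊆ cl_𝔞(int A)`. -/
def auraSemiOpen {X : Type*} [TopologicalSpace X] (a : X → Set X) (A : Set X) : Prop :=
  A ⊆ auraCl a (interior A)

/-- `A` is 𝔞-pre-open if `A ⊆ int (cl_𝔞 A)`. -/
def auraPreOpen {X : Type*} [TopologicalSpace X] (a : X → Set X) (A : Set X) : Prop :=
  A ⊆ interior (auraCl a A)

/-- `A` is 𝔞-α-open if `A ⊆ int (cl_𝔞 (int A))`. -/
def auraAlphaOpen {X : Type*} [TopologicalSpace X] (a : X → Set X) (A : Set X) : Prop :=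
  A ⊆ interior (auraCl a (interior A))

/-- `A` is 𝔞-β-open if `A ⊆ cl_𝔞 (int (cl_𝔞 A))`. -/
def auraBetaOpen {X : Type*} [TopologicalSpace X] (a : X → Set X) (A : Set X) : Prop :=
  A ⊆ auraCl a (interior (auraCl a A))

/-- `A` is 𝔞-b-open if `A ⊆ cl_𝔞(int A) ∪ int(cl_𝔞 A)`. -/
def auraBOpen {X : Type*} [TopologicalSpace X] (a : X → Set X) (A : Set X) : Prop :=
  A ⊆ auraCl a (interior A) ∪ interior (auraCl a A)

/-- The hierarchy of generalized open-set classes in an aura space. -/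
theorem aura_open_hierarchy {X : Type*} [TopologicalSpace X]
    (a : X → Set X) (ha_open : ∀ x, IsOpen (a x)) (ha_mem : ∀ x, x ∈ a x) :
    (∀ A : Set X, IsOpen A → auraAlphaOpen a A) ∧
    (∀ A : Set X, auraAlphaOpen a A → auraSemiOpen a A) ∧
    (∀ A : Set X, auraAlphaOpen a A → auraPreOpen a A) ∧
    (∀ A : Set X, auraSemiOpen a A → auraBOpen a A) ∧
    (∀ A : Set X, auraPreOpen a A → auraBOpen a A) ∧
    (∀ A : Set X, auraBOpen a A → auraBetaOpen a A) := by
  have hsub : ∀ A : Set X, A ⊆ auraCl a A := fun A x hx => ⟨x, ha_mem x, hx⟩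
  have hmono : ∀ A B : Set X, A ⊆ B → auraCl a A ⊆ auraCl a B :=
    fun A B h x ⟨y, hy, hyA⟩ => ⟨y, hy, h hyA⟩
  refine ⟨fun A hA => ?_, fun A hA => ?_, fun A hA => ?_, fun A hA => ?_, fun A hA => ?_,
    fun A hA => ?_⟩
  · apply interior_maximal _ hA
    rw [hA.interior_eq]
    exact hsub A
  · exact fun x hx => interior_subset (hA hx)
  · exact fun x hx => interior_mono (hmono _ _ interior_subset) (hA hx)
  · exact fun x hx => Or.inl (hA hx)
  · exact fun x hx => Or.inr (hA hx)
  · intro x hx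
    rcases hA hx with h | h
    · exact hmono _ _ (interior_mono (hsub A)) h
    · exact hsub _ h
end

section
/- Let X be a topological space and 𝔞 a transitive aura function on X. Then a subset A of X is 𝔞-α-open if and only if it is both 𝔞-semi-open and 𝔞-pre-open. -/
/-- For a transitive aura function, 𝔞-α-open = 𝔞-semi-open ∩ 𝔞-pre-open. -/
theorem auraAlphaOpen_iff_semi_and_pre_of_transitive {X : Type*} [TopologicalSpace X]
    (a : X → Set X) (ha_open : ∀ x, IsOpen (a x)) (ha_mem : ∀ x, x ∈ a x)
    (ha_trans : ∀ x, ∀ y ∈ a x, a y ⊆ a x) (A : Set X) :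
    auraAlphaOpen a A ↔ auraSemiOpen a A ∧ auraPreOpen a A := by
  constructor
  · intro h
    refine ⟨fun x hx => interior_subset (h hx), fun x hx => ?_⟩
    refine interior_mono ?_ (h hx)
    rintro y ⟨z, hz, hzA⟩
    exact ⟨z, hz, interior_subset hzA⟩
  · rintro ⟨hs, hp⟩ x hx
    refine interior_mono ?_ (hp hx)
    rintro y ⟨z, hz, hzA⟩
    obtain ⟨w, hw, hwA⟩ := hs hzA
    exact ⟨w, ha_trans y z hz hw, hwA⟩
end
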